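/- Let Ū : (−1,1) → ℝ be continuous with C₀ > 0 such that |Ū(x) − 2 − 4/ln((1+x)/3)| ≤ C₀(ln((1+x)/3))^{−2} on (−1,0] and |Ū(x) + 2 + 4/ln((1−x)/3)| ≤ C₀(ln((1−x)/3))^{−2} on [0,1). Let ξ : (−1,1) → ℝ be continuous with |ξ(x)| ≤ N(ln((1+x)/3))^{−2}(ln((1−x)/3))^{−2} for all x. Then W(x) := e^{−a(x)} ∫₀ˣ e^{a(s)} ξ(s)/(1−s²) ds is well-defined and C¹ on (−1,1), satisfies (1−x²)W'(x) + (2x + Ū(x))W(x) = ξ(x), and there exists C > 0 depending only on C₀ such that for all x ∈ (−1,1): |ln((1+x)/3)·ln((1−x)/3)·W(x)| ≤ C·N and (1−x²)(ln((1+x)/3))²(ln((1−x)/3))²|W'(x)| ≤ C·N; in particular W(x) → 0 as x → ±1. -/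

import Mathlib

open Set Filter

/-- `a(x) = ∫₀ˣ (2s + Ū(s))/(1−s²) ds`. -/
noncomputable def aF (U : ℝ → ℝ) (x : ℝ) : ℝ := ∫ s in (0:ℝ)..x, (2*s + U s) / (1 - s^2)

/-- `W(x) = e^{−a(x)} ∫₀ˣ e^{a(s)} ξ(s)/(1−s²) ds`. -/
noncomputable def wF (U ξ : ℝ → ℝ) (x : ℝ) : ℝ :=
  Real.exp (-(aF U x)) * ∫ s in (0:ℝ)..x, Real.exp (aF U s) * ξ s / (1-s^2)

lemma one_sub_sq_pos_of_mem_Ioo {x : ℝ} (hx : x ∈ Ioo (-1:ℝ) 1) : 0 < 1 - x^2 := by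
  nlinarith [hx.1, hx.2]

lemma hasDerivAt_integral_of_continuousOn_Ioo {f : ℝ → ℝ} {a b c x : ℝ}
    (hf : ContinuousOn f (Ioo a b)) (hc : c ∈ Ioo a b) (hx : x ∈ Ioo a b) :
    HasDerivAt (fun y => ∫ s in c..y, f s) (f x) x := by
  have hsub : uIcc c x ⊆ Ioo a b := (ordConnected_Ioo).uIcc_subset hc hx
  exact intervalIntegral.integral_hasDerivAt_right
    ((hf.mono hsub).intervalIntegrable)
    (hf.stronglyMeasurableAtFilter isOpen_Ioo x hx)
    (hf.continuousAt (isOpen_Ioo.mem_nhds hx))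

lemma hasDerivAt_aF {U : ℝ → ℝ} (hU : ContinuousOn U (Ioo (-1:ℝ) 1)) {x : ℝ}
    (hx : x ∈ Ioo (-1:ℝ) 1) : HasDerivAt (aF U) ((2*x + U x) / (1 - x^2)) x := by
  refine hasDerivAt_integral_of_continuousOn_Ioo
    (f := fun s => (2*s + U s) / (1 - s^2)) ?_ (by norm_num) hx
  exact ContinuousOn.div (by fun_prop) (by fun_prop)
    fun s hs => (one_sub_sq_pos_of_mem_Ioo hs).ne'

lemma hasDerivAt_integral_exp_aF {U ξ : ℝ → ℝ} (hU : ContinuousOn U (Ioo (-1:ℝ) 1))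
    (hξ : ContinuousOn ξ (Ioo (-1:ℝ) 1)) {x : ℝ} (hx : x ∈ Ioo (-1:ℝ) 1) :
    HasDerivAt (fun y => ∫ s in (0:ℝ)..y, Real.exp (aF U s) * ξ s / (1-s^2))
      (Real.exp (aF U x) * ξ x / (1-x^2)) x := by
  have ha : ContinuousOn (aF U) (Ioo (-1:ℝ) 1) :=
    fun s hs => (hasDerivAt_aF hU hs).continuousAt.continuousWithinAt
  refine hasDerivAt_integral_of_continuousOn_Ioo
    (f := fun s => Real.exp (aF U s) * ξ s / (1-s^2)) ?_ (by norm_num) hx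
  exact ContinuousOn.div (by fun_prop) (by fun_prop)
    fun s hs => (one_sub_sq_pos_of_mem_Ioo hs).ne'

lemma hasDerivAt_wF {U ξ : ℝ → ℝ} (hU : ContinuousOn U (Ioo (-1:ℝ) 1))
    (hξ : ContinuousOn ξ (Ioo (-1:ℝ) 1)) {x : ℝ} (hx : x ∈ Ioo (-1:ℝ) 1) :
    HasDerivAt (wF U ξ) ((ξ x - (2*x + U x) * wF U ξ x) / (1-x^2)) x := by
  have h := (hasDerivAt_aF hU hx).neg.exp.mul (hasDerivAt_integral_exp_aF hU hξ hx)
  refine h.congr_deriv ?_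
  have hexp : Real.exp (-(aF U x)) * Real.exp (aF U x) = 1 := by
    rw [← Real.exp_add]; simp
  have h0 := (one_sub_sq_pos_of_mem_Ioo hx).ne'
  simp only [wF, Pi.neg_apply]
  field_simp
  linear_combination ξ x * hexp

lemma aF_reflect (U : ℝ → ℝ) (x : ℝ) : aF (fun s => -U (-s)) x = aF U (-x) := by
  have h := intervalIntegral.integral_comp_neg (a := 0) (b := x)
    (fun s => (2*s + U s) / (1 - s^2))
  unfold aF
  rw [neg_zero] at h
  rw [intervalIntegral.integral_symm (-x) 0, ← h, ← intervalIntegral.integral_neg]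
  congr 1; ext s; ring

lemma wF_reflect (U ξ : ℝ → ℝ) (x : ℝ) :
    wF (fun s => -U (-s)) (fun s => ξ (-s)) x = -wF U ξ (-x) := by
  have h := intervalIntegral.integral_comp_neg (a := 0) (b := x)
    (fun s => Real.exp (aF U s) * ξ s / (1-s^2))
  rw [neg_zero] at h
  unfold wF
  simp only [aF_reflect]
  rw [intervalIntegral.integral_symm (-x) 0, ← h]
  simp

lemma one_le_neg_log_one_sub_div_three {x : ℝ} (hx : x ∈ Ico (0:ℝ) 1) :
    1 ≤ -Real.log ((1-x)/3) := by
  rw [← Real.log_inv, Real.le_log_iff_exp_le (by have := hx.2; rw [inv_pos]; linarith)]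
  have h1 : (3:ℝ) ≤ ((1-x)/3)⁻¹ := by
    rw [inv_div, le_div_iff₀ (by linarith [hx.2])]; linarith [hx.1]
  linarith [Real.exp_one_lt_three]

lemma neg_log_one_add_div_three_mem {x : ℝ} (hx : x ∈ Ico (0:ℝ) 1) :
    -Real.log ((1+x)/3) ∈ Icc (1/3:ℝ) 2 := by
  have hp : 0 < (1+x)/3 := by linarith [hx.1]
  refine ⟨by linarith [Real.log_le_sub_one_of_pos hp, hx.2], ?_⟩
  have h := Real.log_le_sub_one_of_pos (inv_pos.2 hp)
  rw [Real.log_inv] at h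
  have : ((1+x)/3)⁻¹ ≤ 3 := by
    rw [inv_div, div_le_iff₀ (by linarith [hx.1])]; linarith [hx.1]
  linarith

lemma one_sub_mul_neg_log_le {x : ℝ} (hx : x ∈ Ico (0:ℝ) 1) :
    (1-x) * -Real.log ((1-x)/3) ≤ 3 := by
  have hp : 0 < (1-x)/3 := by linarith [hx.2]
  have h := Real.log_le_sub_one_of_pos (inv_pos.2 hp)
  rw [Real.log_inv] at h
  have h2 := mul_inv_cancel₀ hp.ne'
  nlinarith

lemma hasDerivAt_neg_log_one_sub_div_three {x : ℝ} (hx : x < 1) :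
    HasDerivAt (fun s : ℝ => -Real.log ((1-s)/3)) (1/(1-x)) x := by
  have h1 : HasDerivAt (fun s : ℝ => (1-s)/3) (-1/3) x :=
    ((hasDerivAt_id x).const_sub 1).div_const 3
  refine (h1.log (by linarith)).neg.congr_deriv ?_
  have : 1 - x ≠ 0 := by linarith
  field_simp

/-- `e^a` is comparable with the square of the logarithm near `1`. -/
lemma exp_aF_le {C₀ : ℝ} (hC₀ : 0 < C₀) {U : ℝ → ℝ} (hU : ContinuousOn U (Ioo (-1:ℝ) 1))
    (hU1 : ∀ x ∈ Ico (0:ℝ) 1,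
        |U x + 2 + 4 / Real.log ((1-x)/3)| ≤ C₀ / (Real.log ((1-x)/3))^2)
    {s x : ℝ} (hs : 0 ≤ s) (hsx : s ≤ x) (hx : x < 1) :
    Real.exp (aF U s) * (Real.log ((1-x)/3))^2 ≤
      Real.exp (2 + C₀) * Real.exp (aF U x) * (Real.log ((1-s)/3))^2 := by
  set l : ℝ → ℝ := fun s => -Real.log ((1-s)/3) with hl
  have hl1 : ∀ y ∈ Ico (0:ℝ) 1, 1 ≤ l y := fun y hy => one_le_neg_log_one_sub_div_three hy
  have hderiv : ∀ y ∈ Ico (0:ℝ) 1, HasDerivAt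
      (fun y => aF U y - 2 * Real.log (l y) + (2 * y - C₀ * (l y)⁻¹))
      ((2*y + U y) / (1 - y^2) - 2 * (1/(1-y) / l y)
        + (2 - C₀ * (-(1/(1-y)) / (l y)^2))) y := by
    intro y hy
    have hly := hasDerivAt_neg_log_one_sub_div_three hy.2
    have hne : l y ≠ 0 := by linarith [hl1 y hy]
    have h1 := (hasDerivAt_aF hU (x := y) ⟨by linarith [hy.1], hy.2⟩).sub
      ((hly.log hne).const_mul 2)
    have h2 := ((hasDerivAt_id y).const_mul 2).sub ((hly.inv hne).const_mul C₀)
    refine (h1.add h2).congr_deriv ?_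
    ring
  have hmono : MonotoneOn
      (fun y => aF U y - 2 * Real.log (l y) + (2 * y - C₀ * (l y)⁻¹)) (Ico 0 1) := by
    refine monotoneOn_of_deriv_nonneg (convex_Ico 0 1)
      (fun y hy => (hderiv y hy).continuousAt.continuousWithinAt)
      (fun y hy => (hderiv y (interior_subset hy)).differentiableAt.differentiableWithinAt) ?_
    intro y hy
    have hy := interior_subset hy
    rw [(hderiv y hy).deriv]
    have hly := hl1 y hy
    have hb := (abs_le.1 (hU1 y hy)).1
    have hlog : Real.log ((1-y)/3) = -l y := by simp [hl]
    rw [hlog] at hb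
    have hy1 : 0 < 1 - y := by linarith [hy.2]
    have hy2 : 0 < 1 + y := by linarith [hy.1]
    have hlp : 0 < l y := by linarith
    set L := l y
    set r := U y + 2 + 4 / -L with hr
    have hUy : U y = r - 2 + 4 / L := by rw [hr, div_neg]; ring
    have key : (2*y + U y) / (1 - y^2) - 2 * (1/(1-y) / L)
        + (2 - C₀ * (-(1/(1-y)) / L^2))
        = (r + C₀ / L^2) / ((1-y)*(1+y)) + C₀ * y / (L^2 * ((1-y)*(1+y)))
          + 2 * y / (1+y) + 2 / (L * (1+y)) := by
      rw [hUy, show 1 - y^2 = (1-y)*(1+y) by ring]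
      field_simp
      ring
    rw [key]
    have hr0 : 0 ≤ r + C₀ / L^2 := by
      rw [neg_sq] at hb; linarith
    have := hy.1
    positivity
  have hs' : s ∈ Ico (0:ℝ) 1 := ⟨hs, by linarith⟩
  have hx' : x ∈ Ico (0:ℝ) 1 := ⟨by linarith, hx⟩
  have hm := hmono hs' hx' hsx
  have hls := hl1 s hs'
  have hlx := hl1 x hx'
  have h1 : C₀ * (l s)⁻¹ ≤ C₀ := by
    have := inv_le_one_of_one_le₀ hls
    nlinarith
  have h2 : 0 ≤ C₀ * (l x)⁻¹ := by positivity
  have h3 : aF U s + 2 * Real.log (l x) ≤ (2 + C₀) + aF U x + 2 * Real.log (l s) := by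
    simp only at hm; linarith
  have hsq : ∀ {z : ℝ}, 1 ≤ z → Real.exp (2 * Real.log z) = z^2 := fun {z} hz => by
    rw [two_mul, Real.exp_add, Real.exp_log (by linarith), sq]
  have h4 := Real.exp_le_exp.2 h3
  rw [Real.exp_add, Real.exp_add, Real.exp_add, hsq hls, hsq hlx] at h4
  simpa [hl] using h4

/-- The weighted bound on `W` over `[0,1)`. -/
lemma abs_wF_le {C₀ N : ℝ} (hC₀ : 0 < C₀) {U ξ : ℝ → ℝ} (hU : ContinuousOn U (Ioo (-1:ℝ) 1))
    (hU1 : ∀ x ∈ Ico (0:ℝ) 1,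
        |U x + 2 + 4 / Real.log ((1-x)/3)| ≤ C₀ / (Real.log ((1-x)/3))^2)
    (hξ : ContinuousOn ξ (Ioo (-1:ℝ) 1)) (hN : 0 ≤ N)
    (hξN : ∀ x ∈ Ioo (-1:ℝ) 1,
        |ξ x| ≤ N / ((Real.log ((1+x)/3))^2 * (Real.log ((1-x)/3))^2))
    {x : ℝ} (hx : x ∈ Ico (0:ℝ) 1) :
    |wF U ξ x| * -Real.log ((1-x)/3) ≤ 9 * Real.exp (2 + C₀) * N := by
  set l : ℝ → ℝ := fun s => -Real.log ((1-s)/3) with hl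
  have hlx : 1 ≤ l x := one_le_neg_log_one_sub_div_three hx
  set B : ℝ := 9 * Real.exp (2 + C₀) * Real.exp (aF U x) * N / (l x)^2 with hB
  have hB0 : 0 ≤ B := by positivity
  have hmem : ∀ {y}, y ∈ Icc 0 x → y ∈ Ioo (-1:ℝ) 1 := fun hy =>
    ⟨by linarith [hy.1], by linarith [hy.2, hx.2]⟩
  have hF := image_norm_le_of_norm_deriv_right_le_deriv_boundary' (a := 0) (b := x)
    (f := fun y => ∫ s in (0:ℝ)..y, Real.exp (aF U s) * ξ s / (1-s^2))
    (f' := fun y => Real.exp (aF U y) * ξ y / (1-y^2))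
    (B := fun y => B * l y) (B' := fun y => B * (1/(1-y)))
    (fun y hy => (hasDerivAt_integral_exp_aF hU hξ (hmem hy)).continuousAt.continuousWithinAt)
    (fun y hy => (hasDerivAt_integral_exp_aF hU hξ
      (hmem (Ico_subset_Icc_self hy))).hasDerivWithinAt)
    (by
      have : 0 ≤ l 0 := by
        have := one_le_neg_log_one_sub_div_three (x := 0) (by norm_num)
        simp only [hl]; linarith
      simp only [intervalIntegral.integral_same, norm_zero]
      positivity)
    (fun y hy => ((hasDerivAt_neg_log_one_sub_div_three
      (hmem hy).2).const_mul B).continuousAt.continuousWithinAt)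
    (fun y hy => ((hasDerivAt_neg_log_one_sub_div_three
      (hmem (Ico_subset_Icc_self hy)).2).const_mul B).hasDerivWithinAt)
    (by
      intro y hy
      have hyI := hmem (Ico_subset_Icc_self hy)
      have hyI0 : y ∈ Ico (0:ℝ) 1 := ⟨hy.1, hyI.2⟩
      have hE := exp_aF_le hC₀ hU hU1 hy.1 hy.2.le hx.2
      have hm := neg_log_one_add_div_three_mem hyI0
      have hly := one_le_neg_log_one_sub_div_three hyI0
      have hξy := hξN y hyI
      have hpos := one_sub_sq_pos_of_mem_Ioo hyI
      have hy1 : 0 < 1 - y := by linarith [hyI.2]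
      have hlx2 : (Real.log ((1-x)/3))^2 = (l x)^2 := by simp [hl]
      rw [hlx2] at hE
      set m := Real.log ((1+y)/3)
      set n := Real.log ((1-y)/3)
      have hm2 : 1 ≤ 9 * m^2 := by nlinarith [hm.1]
      have hn2 : 0 < n^2 := by nlinarith
      have hξ9 : |ξ y| * n^2 ≤ 9 * N := by
        rw [le_div_iff₀ (mul_pos (by linarith) hn2)] at hξy
        have : 0 ≤ |ξ y| * n^2 := by positivity
        nlinarith
      rw [Real.norm_eq_abs, abs_div, abs_mul, abs_of_pos (Real.exp_pos _), abs_of_pos hpos]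
      have hnum : Real.exp (aF U y) * |ξ y| ≤ B := by
        rw [hB, le_div_iff₀ (by positivity)]
        calc Real.exp (aF U y) * |ξ y| * (l x)^2
            = (Real.exp (aF U y) * (l x)^2) * |ξ y| := by ring
          _ ≤ (Real.exp (2 + C₀) * Real.exp (aF U x) * n^2) * |ξ y| := by gcongr
          _ = Real.exp (2 + C₀) * Real.exp (aF U x) * (|ξ y| * n^2) := by ring
          _ ≤ Real.exp (2 + C₀) * Real.exp (aF U x) * (9 * N) := by gcongr
          _ = _ := by ring
      rw [mul_one_div]
      have hle : 1 - y ≤ 1 - y^2 := by nlinarith [hy.1]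
      gcongr)
    (right_mem_Icc.2 hx.1)
  rw [Real.norm_eq_abs] at hF
  rw [wF, abs_mul, abs_of_pos (Real.exp_pos _)]
  calc Real.exp (-(aF U x)) * |∫ s in (0:ℝ)..x, Real.exp (aF U s) * ξ s / (1-s^2)| * l x
      ≤ Real.exp (-(aF U x)) * (B * l x) * l x := by gcongr
    _ = (Real.exp (-(aF U x)) * Real.exp (aF U x)) * (9 * Real.exp (2 + C₀) * N) := by
        rw [hB]; field_simp
    _ = _ := by rw [← Real.exp_add]; simp

/-- The two weighted estimates on `[0,1)`. -/
lemma weighted_bounds_wF {C₀ N : ℝ} (hC₀ : 0 < C₀) {U ξ : ℝ → ℝ}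
    (hU : ContinuousOn U (Ioo (-1:ℝ) 1))
    (hU1 : ∀ x ∈ Ico (0:ℝ) 1,
        |U x + 2 + 4 / Real.log ((1-x)/3)| ≤ C₀ / (Real.log ((1-x)/3))^2)
    (hξ : ContinuousOn ξ (Ioo (-1:ℝ) 1)) (hN : 0 ≤ N)
    (hξN : ∀ x ∈ Ioo (-1:ℝ) 1,
        |ξ x| ≤ N / ((Real.log ((1+x)/3))^2 * (Real.log ((1-x)/3))^2))
    {x : ℝ} (hx : x ∈ Ico (0:ℝ) 1) :
    |Real.log ((1+x)/3) * Real.log ((1-x)/3) * wF U ξ x|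
        ≤ (1 + 36 * (10 + C₀) * Real.exp (2 + C₀)) * N ∧
      (Real.log ((1+x)/3))^2 * (Real.log ((1-x)/3))^2 * |ξ x - (2*x + U x) * wF U ξ x|
        ≤ (1 + 36 * (10 + C₀) * Real.exp (2 + C₀)) * N := by
  have hW := abs_wF_le hC₀ hU hU1 hξ hN hξN hx
  have hm := neg_log_one_add_div_three_mem hx
  have hl := one_le_neg_log_one_sub_div_three hx
  have hxl := one_sub_mul_neg_log_le hx
  have hξx := hξN x ⟨by linarith [hx.1], hx.2⟩
  have hUx := hU1 x hx
  have hx1 : 0 < 1 - x := by linarith [hx.2]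
  set w := wF U ξ x
  set E := Real.exp (2 + C₀)
  have hE : 0 < E := Real.exp_pos _
  obtain ⟨m, hmdef⟩ : ∃ m, Real.log ((1+x)/3) = -m := ⟨_, (neg_neg _).symm⟩
  obtain ⟨l, hldef⟩ : ∃ l, Real.log ((1-x)/3) = -l := ⟨_, (neg_neg _).symm⟩
  simp only [hmdef, hldef, neg_neg, neg_sq] at hW hm hl hxl hξx hUx ⊢
  have hEN : 0 ≤ E * N := by positivity
  have hCEN : 0 ≤ C₀ * (E * N) := by positivity
  have hlp : 0 < l := by linarith
  have hmp : 0 < m := by linarith [hm.1]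
  constructor
  · rw [neg_mul_neg, abs_mul, abs_of_pos (by positivity)]
    calc m * l * |w| = m * (|w| * l) := by ring
      _ ≤ 2 * (9 * E * N) := by gcongr; exact hm.2
      _ ≤ _ := by nlinarith
  · have hcoef : |2*x + U x| * l ≤ 10 + C₀ := by
      have heq : 2*x + U x = (U x + 2 + 4 / -l) + (4 / l - 2 * (1-x)) := by
        rw [div_neg]; ring
      have h1 : |2*x + U x| ≤ C₀ / l^2 + (4 / l + 2 * (1-x)) := by
        rw [heq]
        refine (abs_add_le _ _).trans (add_le_add hUx ?_)
        refine (abs_sub _ _).trans ?_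
        rw [abs_of_pos (by positivity), abs_of_pos (by positivity)]
      calc |2*x + U x| * l ≤ (C₀ / l^2 + (4 / l + 2 * (1-x))) * l := by gcongr
        _ = C₀ / l + 4 + 2 * ((1-x) * l) := by field_simp; ring
        _ ≤ C₀ + 4 + 2 * 3 := by gcongr; exact div_le_self hC₀.le hl
        _ = _ := by ring
    have hξ1 : m^2 * l^2 * |ξ x| ≤ N := by
      rw [le_div_iff₀ (by positivity)] at hξx; linarith
    calc m^2 * l^2 * |ξ x - (2*x + U x) * w|
        ≤ m^2 * l^2 * (|ξ x| + |2*x + U x| * |w|) := by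
          gcongr
          rw [← abs_mul]
          exact abs_sub _ _
      _ = m^2 * l^2 * |ξ x| + m^2 * ((|2*x + U x| * l) * (|w| * l)) := by ring
      _ ≤ N + 2^2 * ((10 + C₀) * (9 * E * N)) := by gcongr; exact hm.2
      _ = _ := by ring

lemma tendsto_wF_one {C₀ N : ℝ} (hC₀ : 0 < C₀) {U ξ : ℝ → ℝ}
    (hU : ContinuousOn U (Ioo (-1:ℝ) 1))
    (hU1 : ∀ x ∈ Ico (0:ℝ) 1,
        |U x + 2 + 4 / Real.log ((1-x)/3)| ≤ C₀ / (Real.log ((1-x)/3))^2)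
    (hξ : ContinuousOn ξ (Ioo (-1:ℝ) 1)) (hN : 0 ≤ N)
    (hξN : ∀ x ∈ Ioo (-1:ℝ) 1,
        |ξ x| ≤ N / ((Real.log ((1+x)/3))^2 * (Real.log ((1-x)/3))^2)) :
    Tendsto (wF U ξ) (nhdsWithin (1:ℝ) (Ioo (-1:ℝ) 1)) (nhds 0) := by
  have hlog : Tendsto (fun x : ℝ => -Real.log ((1-x)/3))
      (nhdsWithin (1:ℝ) (Ioo (-1:ℝ) 1)) atTop := by
    refine tendsto_neg_atBot_atTop.comp (Real.tendsto_log_nhdsGT_zero.comp ?_)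
    refine tendsto_nhdsWithin_iff.2 ⟨?_, ?_⟩
    · have : Tendsto (fun x : ℝ => (1-x)/3) (nhds 1) (nhds ((1-1)/3)) :=
        Continuous.tendsto (by fun_prop) 1
      rw [sub_self, zero_div] at this
      exact this.mono_left nhdsWithin_le_nhds
    · filter_upwards [self_mem_nhdsWithin] with x hx
      have := hx.2
      simp only [mem_Ioi]; linarith
  refine squeeze_zero_norm' ?_ (hlog.const_div_atTop (9 * Real.exp (2 + C₀) * N))
  filter_upwards [self_mem_nhdsWithin,
    mem_nhdsWithin_of_mem_nhds (Ioi_mem_nhds (zero_lt_one' ℝ))] with x hx hx0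
  have hx' : x ∈ Ico (0:ℝ) 1 := ⟨le_of_lt hx0, hx.2⟩
  have hl := one_le_neg_log_one_sub_div_three hx'
  rw [Real.norm_eq_abs, le_div_iff₀ (by linarith)]
  exact abs_wF_le hC₀ hU hU1 hξ hN hξN hx'

/-- doubly logarithmic case (`Ū → 2` with `η₁ = 4` at `−1` and
`Ū → −2` with `η₂ = −4` at `1`): `W(x) = e^{−a(x)} ∫₀ˣ e^{a(s)} ξ(s)/(1−s²) ds`
solves `(1−x²)W' + (2x+Ū)W = ξ` with doubly-log-weighted `C·N` bounds and
`W → 0` at `±1`. -/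
theorem stmt15 (C₀ : ℝ) (hC₀ : 0 < C₀) :
    ∃ C > 0, ∀ (U ξ : ℝ → ℝ) (N : ℝ),
      ContinuousOn U (Ioo (-1:ℝ) 1) →
      (∀ x ∈ Ioc (-1:ℝ) 0,
        |U x - 2 - 4 / Real.log ((1+x)/3)| ≤ C₀ / (Real.log ((1+x)/3))^2) →
      (∀ x ∈ Ico (0:ℝ) 1,
        |U x + 2 + 4 / Real.log ((1-x)/3)| ≤ C₀ / (Real.log ((1-x)/3))^2) →
      ContinuousOn ξ (Ioo (-1:ℝ) 1) →
      (∀ x ∈ Ioo (-1:ℝ) 1,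
        |ξ x| ≤ N / ((Real.log ((1+x)/3))^2 * (Real.log ((1-x)/3))^2)) →
      (let W : ℝ → ℝ := fun x =>
        Real.exp (-(aF U x)) * ∫ s in (0:ℝ)..x, Real.exp (aF U s) * ξ s / (1-s^2)
       ∃ W' : ℝ → ℝ,
        ContinuousOn W' (Ioo (-1:ℝ) 1) ∧
        (∀ x ∈ Ioo (-1:ℝ) 1, HasDerivAt W (W' x) x) ∧
        (∀ x ∈ Ioo (-1:ℝ) 1, (1-x^2) * W' x + (2*x + U x) * W x = ξ x) ∧
        (∀ x ∈ Ioo (-1:ℝ) 1,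
          |Real.log ((1+x)/3) * Real.log ((1-x)/3) * W x| ≤ C * N ∧
          (1-x^2) * (Real.log ((1+x)/3))^2 * (Real.log ((1-x)/3))^2 * |W' x|
            ≤ C * N) ∧
        Tendsto W (nhdsWithin (-1:ℝ) (Ioo (-1:ℝ) 1)) (nhds 0) ∧
        Tendsto W (nhdsWithin (1:ℝ) (Ioo (-1:ℝ) 1)) (nhds 0)) := by
  refine ⟨1 + 36 * (10 + C₀) * Real.exp (2 + C₀), by positivity, ?_⟩
  intro U ξ N hU hUl hUr hξ hξN
  change ∃ W' : ℝ → ℝ, ContinuousOn W' (Ioo (-1:ℝ) 1) ∧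
    (∀ x ∈ Ioo (-1:ℝ) 1, HasDerivAt (wF U ξ) (W' x) x) ∧
    (∀ x ∈ Ioo (-1:ℝ) 1, (1-x^2) * W' x + (2*x + U x) * wF U ξ x = ξ x) ∧
    (∀ x ∈ Ioo (-1:ℝ) 1,
      |Real.log ((1+x)/3) * Real.log ((1-x)/3) * wF U ξ x| ≤ _ * N ∧
      (1-x^2) * (Real.log ((1+x)/3))^2 * (Real.log ((1-x)/3))^2 * |W' x| ≤ _ * N) ∧
    Tendsto (wF U ξ) (nhdsWithin (-1:ℝ) (Ioo (-1:ℝ) 1)) (nhds 0) ∧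
    Tendsto (wF U ξ) (nhdsWithin (1:ℝ) (Ioo (-1:ℝ) 1)) (nhds 0)
  have hN : 0 ≤ N := by
    have h0 : (0:ℝ) ∈ Ico (0:ℝ) 1 := by norm_num
    have h := (abs_nonneg _).trans (hξN 0 (by norm_num))
    have hl := one_le_neg_log_one_sub_div_three h0
    have hm := (neg_log_one_add_div_three_mem h0).1
    rwa [le_div_iff₀ (mul_pos (by nlinarith) (by nlinarith)), zero_mul] at h
  have hneg : MapsTo (fun x : ℝ => -x) (Ioo (-1:ℝ) 1) (Ioo (-1:ℝ) 1) :=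
    fun x hx => ⟨by linarith [hx.2], by linarith [hx.1]⟩
  have hV : ContinuousOn (fun s => -U (-s)) (Ioo (-1:ℝ) 1) :=
    (hU.comp continuousOn_neg hneg).neg
  have hη : ContinuousOn (fun s => ξ (-s)) (Ioo (-1:ℝ) 1) := hξ.comp continuousOn_neg hneg
  have hVr : ∀ x ∈ Ico (0:ℝ) 1,
      |-U (-x) + 2 + 4 / Real.log ((1-x)/3)| ≤ C₀ / (Real.log ((1-x)/3))^2 := by
    intro x hx
    have h := hUl (-x) ⟨by linarith [hx.2], by linarith [hx.1]⟩
    rw [← sub_eq_add_neg, ← abs_neg] at h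
    convert h using 2
    ring
  have hηN : ∀ x ∈ Ioo (-1:ℝ) 1,
      |ξ (-x)| ≤ N / ((Real.log ((1+x)/3))^2 * (Real.log ((1-x)/3))^2) := by
    intro x hx
    have h := hξN (-x) (hneg hx)
    rwa [sub_neg_eq_add, ← sub_eq_add_neg, mul_comm ((Real.log ((1-x)/3))^2)] at h
  have hbounds : ∀ x ∈ Ioo (-1:ℝ) 1,
      |Real.log ((1+x)/3) * Real.log ((1-x)/3) * wF U ξ x|
          ≤ (1 + 36 * (10 + C₀) * Real.exp (2 + C₀)) * N ∧
        (Real.log ((1+x)/3))^2 * (Real.log ((1-x)/3))^2 * |ξ x - (2*x + U x) * wF U ξ x|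
          ≤ (1 + 36 * (10 + C₀) * Real.exp (2 + C₀)) * N := by
    intro x hx
    rcases le_total 0 x with h0 | h0
    · exact weighted_bounds_wF hC₀ hU hUr hξ hN hξN ⟨h0, hx.2⟩
    · have h := weighted_bounds_wF hC₀ hV hVr hη hN hηN (x := -x)
        ⟨by linarith, by linarith [hx.1]⟩
      simp only [wF_reflect, neg_neg, sub_neg_eq_add, ← sub_eq_add_neg] at h
      refine ⟨?_, ?_⟩
      · rw [← abs_neg]
        convert h.1 using 2
        ring
      · convert h.2 using 1
        rw [mul_comm ((Real.log ((1+x)/3))^2)]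
        congr 2
        ring
  refine ⟨fun x => (ξ x - (2*x + U x) * wF U ξ x) / (1-x^2), ?_,
    fun x hx => hasDerivAt_wF hU hξ hx, ?_, ?_, ?_,
    tendsto_wF_one hC₀ hU hUr hξ hN hξN⟩
  · have hW : ContinuousOn (wF U ξ) (Ioo (-1:ℝ) 1) :=
      fun s hs => (hasDerivAt_wF hU hξ hs).continuousAt.continuousWithinAt
    exact ContinuousOn.div (by fun_prop) (by fun_prop)
      fun s hs => (one_sub_sq_pos_of_mem_Ioo hs).ne'
  · intro x hx
    have := (one_sub_sq_pos_of_mem_Ioo hx).ne'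
    field_simp
    ring
  · intro x hx
    refine ⟨(hbounds x hx).1, ?_⟩
    have hpos := one_sub_sq_pos_of_mem_Ioo hx
    convert (hbounds x hx).2 using 1
    rw [abs_div, abs_of_pos hpos]
    field_simp
  · have h := tendsto_wF_one hC₀ hV hVr hη hN hηN
    have ht : Tendsto (fun x : ℝ => -x) (nhdsWithin (-1:ℝ) (Ioo (-1:ℝ) 1))
        (nhdsWithin (1:ℝ) (Ioo (-1:ℝ) 1)) := by
      have := (continuous_neg (G := ℝ)).continuousWithinAt.tendsto_nhdsWithin (x := -1) hneg
      rwa [neg_neg] at this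
    have h2 := (h.comp ht).neg
    rw [neg_zero] at h2
    refine h2.congr fun x => ?_
    simp [wF_reflect]
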